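/- Let H > 0, ε > 0, and for each i = 1,…,n let D_i and D̂_i be arbitrary probability distributions supported on (−∞, H] such that the Kolmogorov distance satisfies ‖D_i − D̂_i‖_K ≤ ε. Then OPT(D̂) ≥ OPT(D) − 3nH·ε, where D = ×_{i=1}^n D_i and D̂ = ×_{i=1}^n D̂_i. -/

import Mathlib

open MeasureTheory Set

namespace SingleItem

/-- A single-item mechanism for `n` bidders: (expected) allocation probabilities and
(expected) payments on each bid profile. -/
structure Mech (n : ℕ) where
  alloc : (Fin n → ℝ) → Fin n → ℝ
  pay : (Fin n → ℝ) → Fin n → ℝ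
  alloc_nonneg : ∀ b i, 0 ≤ alloc b i
  alloc_sum_le_one : ∀ b, ∑ i, alloc b i ≤ 1
  meas_alloc : ∀ i, Measurable fun b => alloc b i
  meas_pay : ∀ i, Measurable fun b => pay b i

/-- Utility of bidder `i` with value `vi` when the bid profile is `b`. -/
def util {n : ℕ} (M : Mech n) (i : Fin n) (vi : ℝ) (b : Fin n → ℝ) : ℝ :=
  vi * M.alloc b i - M.pay b i

/-- Dominant-strategy incentive compatibility. -/
def DSIC {n : ℕ} (M : Mech n) : Prop :=
  ∀ (i : Fin n) (v : Fin n → ℝ) (v' : ℝ),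
    util M i (v i) (Function.update v i v') ≤ util M i (v i) v

/-- (Ex-post) individual rationality. -/
def IR {n : ℕ} (M : Mech n) : Prop :=
  ∀ (i : Fin n) (v : Fin n → ℝ), 0 ≤ util M i (v i) v

/-- Expected revenue of a mechanism under (truthful) bids drawn from `D`. -/
noncomputable def Rev {n : ℕ} (M : Mech n) (D : Measure (Fin n → ℝ)) : ℝ :=
  ∫ b, (∑ i, M.pay b i) ∂D

/-- Optimal revenue over DSIC and IR mechanisms. -/
noncomputable def OPT {n : ℕ} (D : Measure (Fin n → ℝ)) : ℝ :=
  sSup {r | ∃ M : Mech n, DSIC M ∧ IR M ∧ r = Rev M D}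

/-- The Lévy distance between `P` and `Q` is at most `ε`. -/
def LevyLe (P Q : Measure ℝ) (ε : ℝ) : Prop :=
  ∀ x : ℝ, (P (Iic (x - ε))).toReal - ε ≤ (Q (Iic x)).toReal ∧
    (Q (Iic x)).toReal ≤ (P (Iic (x + ε))).toReal + ε

/-- The Kolmogorov distance between `P` and `Q` is at most `ε`. -/
def KolmogorovLe (P Q : Measure ℝ) (ε : ℝ) : Prop :=
  ∀ x : ℝ, |(P (Iic x)).toReal - (Q (Iic x)).toReal| ≤ ε

end SingleItem

open SingleItem

namespace SingleItem

/-- Myerson payment for a one-dimensional monotone allocation rule. -/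
noncomputable def myPay (X : ℝ → ℝ) (b : ℝ) : ℝ := b * X b - ∫ s in (0:ℝ)..b, X s

lemma slope_le_integral {X : ℝ → ℝ} (hX : Monotone X) (a b : ℝ) :
    (b - a) * X a ≤ ∫ s in a..b, X s := by
  rcases le_total a b with h | h
  · have := intervalIntegral.integral_mono_on (μ := volume) h (f := fun _ => X a) (g := X)
      (intervalIntegrable_const) (hX.intervalIntegrable) (fun x hx => hX hx.1)
    simpa using this
  · rw [intervalIntegral.integral_symm]
    have := intervalIntegral.integral_mono_on (μ := volume) h (g := fun _ => X a) (f := X)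
      (hX.intervalIntegrable) (intervalIntegrable_const) (fun x hx => hX hx.2)
    simp at this
    linarith

lemma myPay_ic {X : ℝ → ℝ} (hX : Monotone X) (b b' : ℝ) :
    b * X b' - myPay X b' ≤ b * X b - myPay X b := by
  have h := slope_le_integral hX b' b
  have h2 := intervalIntegral.integral_add_adjacent_intervals (μ := volume)
    (hX.intervalIntegrable (a := 0) (b := b')) (hX.intervalIntegrable (a := b') (b := b))
  unfold myPay
  linarith

lemma integral_zero_of_nonpos {X : ℝ → ℝ} (hz : ∀ s ≤ 0, X s = 0) {b : ℝ} (hb : b ≤ 0) :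
    ∫ s in (0:ℝ)..b, X s = 0 := by
  rw [intervalIntegral.integral_congr (g := fun _ => (0:ℝ))]
  · simp
  · intro s hs
    rw [uIcc_of_ge hb] at hs
    exact hz s hs.2

lemma myPay_ir {X : ℝ → ℝ} (h0 : ∀ s, 0 ≤ X s) (hz : ∀ s ≤ 0, X s = 0) (b : ℝ) :
    0 ≤ b * X b - myPay X b := by
  unfold myPay
  rcases le_total b 0 with h | h
  · rw [integral_zero_of_nonpos hz h]; simp
  · have := intervalIntegral.integral_nonneg (μ := volume) h (fun s _ => h0 s)
    linarith

lemma myPay_nonneg {X : ℝ → ℝ} (hX : Monotone X) (b : ℝ) : 0 ≤ myPay X b := by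
  have h := slope_le_integral hX b 0
  rw [intervalIntegral.integral_symm] at h
  unfold myPay
  linarith

/-- Comparison of Myerson payments. -/
lemma myPay_mono {X Y : ℝ → ℝ} (hX : Monotone X) (hY : Monotone Y) {t b : ℝ} (ht : 0 ≤ t)
    (he : Y b = X t) (hle : ∀ s, Y s ≤ X s) : myPay X t ≤ myPay Y b := by
  have h1 := slope_le_integral hY b t
  rw [intervalIntegral.integral_symm] at h1
  have h2 := intervalIntegral.integral_add_adjacent_intervals (μ := volume)
    (hY.intervalIntegrable (a := 0) (b := t)) (hY.intervalIntegrable (a := t) (b := b))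
  have h3 := intervalIntegral.integral_mono_on (μ := volume) ht (hY.intervalIntegrable)
    (hX.intervalIntegrable) (fun s _ => hle s)
  unfold myPay
  rw [he] at h1 ⊢
  nlinarith

lemma ic_mono {X P : ℝ → ℝ} (hic : ∀ s s', s * X s' - P s' ≤ s * X s - P s) : Monotone X := by
  intro a b hab
  rcases hab.eq_or_lt with rfl | h
  · rfl
  · by_contra hc
    push Not at hc
    nlinarith [hic a b, hic b a]

/-- Upper bound on the payment of an IC and IR rule. -/
lemma pay_le_myPay {X P : ℝ → ℝ} (h0 : ∀ s, 0 ≤ X s) (h1 : ∀ s, X s ≤ 1)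
    (hic : ∀ s s', s * X s' - P s' ≤ s * X s - P s)
    (hir : ∀ s, 0 ≤ s * X s - P s) {t : ℝ} (ht : 0 ≤ t) : P t ≤ myPay X t := by
  have hX := ic_mono hic
  set g : ℝ → ℝ := fun t => (t * X t - P t) - ∫ s in (0:ℝ)..t, X s with hg
  have key : ∀ a b, g a - g b ≤ (b - a) * (X b - X a) := by
    intro a b
    have h := slope_le_integral hX b a
    rw [intervalIntegral.integral_symm] at h
    have h2 := intervalIntegral.integral_add_adjacent_intervals (μ := volume)
      (hX.intervalIntegrable (a := 0) (b := a)) (hX.intervalIntegrable (a := a) (b := b))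
    have h3 := hic b a
    simp only [hg]
    nlinarith
  have step : ∀ N : ℕ, g 0 - g t ≤ t / (N + 1) := by
    intro N
    set c : ℝ := t / (N + 1) with hc
    have hc0 : 0 ≤ c := by positivity
    have : ∀ k : ℕ, g 0 - g (k * c) ≤ c * (X (k * c) - X 0) := by
      intro k
      induction k with
      | zero => simp
      | succ k ih =>
        have := key (k * c) ((k + 1 : ℕ) * c)
        push_cast at this ⊢
        nlinarith
    have h := this (N + 1)
    have e : ((N + 1 : ℕ) : ℝ) * c = t := by
      rw [hc]; push_cast; field_simp
    rw [e] at h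
    nlinarith [h0 0, h1 t]
  have hlim : Filter.Tendsto (fun N : ℕ => t / ((N : ℝ) + 1)) Filter.atTop (nhds 0) := by
    simpa [div_eq_mul_inv] using (tendsto_one_div_add_atTop_nhds_zero_nat (𝕜 := ℝ)).const_mul t
  have h := ge_of_tendsto' hlim step
  have := hir 0
  simp only [hg] at h
  simp at h this
  unfold myPay
  linarith

lemma measurable_integral_param {α : Type*} [MeasurableSpace α] {G : α × ℝ → ℝ}
    (hG : Measurable G) {g : α → ℝ} (hg : Measurable g) :
    Measurable fun a => ∫ s in (0:ℝ)..g a, G (a, s) := by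
  unfold intervalIntegral
  refine Measurable.sub ?_ ?_
  · simp_rw [← integral_indicator measurableSet_Ioc]
    have hS : MeasurableSet {p : α × ℝ | 0 < p.2 ∧ p.2 ≤ g p.1} :=
      (measurableSet_lt measurable_const measurable_snd).inter
        (measurableSet_le measurable_snd (hg.comp measurable_fst))
    have := ((hG.indicator hS).stronglyMeasurable.integral_prod_right' (ν := volume)).measurable
    exact this
  · simp_rw [← integral_indicator measurableSet_Ioc]
    have hS : MeasurableSet {p : α × ℝ | g p.1 < p.2 ∧ p.2 ≤ 0} :=
      (measurableSet_lt (hg.comp measurable_fst) measurable_snd).inter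
        (measurableSet_le measurable_snd measurable_const)
    have := ((hG.indicator hS).stronglyMeasurable.integral_prod_right' (ν := volume)).measurable
    exact this

end SingleItem

namespace SingleItem

/-- Randomized distributional transform. -/
noncomputable def RT (ν : Measure ℝ) (p : ℝ × unitInterval) : ℝ :=
  (1 - (p.2 : ℝ)) * ν.real (Iio p.1) + p.2 * ν.real (Iic p.1)

lemma mono_Iio (ν : Measure ℝ) [IsProbabilityMeasure ν] : Monotone fun b => ν.real (Iio b) :=
  fun _ _ h => measureReal_mono (Iio_subset_Iio h)

lemma mono_Iic (ν : Measure ℝ) [IsProbabilityMeasure ν] : Monotone fun b => ν.real (Iic b) :=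
  fun _ _ h => measureReal_mono (Iic_subset_Iic.2 h)

lemma Iio_le_Iic (ν : Measure ℝ) [IsProbabilityMeasure ν] (b : ℝ) :
    ν.real (Iio b) ≤ ν.real (Iic b) := measureReal_mono Iio_subset_Iic_self

lemma RT_meas (ν : Measure ℝ) [IsProbabilityMeasure ν] : Measurable (RT ν) := by
  have h1 := (mono_Iio ν).measurable
  have h2 := (mono_Iic ν).measurable
  have h3 : Measurable fun p : ℝ × unitInterval => (p.2 : ℝ) :=
    measurable_subtype_coe.comp measurable_snd
  exact ((measurable_const.sub h3).mul (h1.comp measurable_fst)).add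
    (h3.mul (h2.comp measurable_fst))

lemma RT_le (ν : Measure ℝ) [IsProbabilityMeasure ν] (p) : RT ν p ≤ ν.real (Iic p.1) := by
  have := Iio_le_Iic ν p.1
  have h0 := p.2.2.1
  have h1 := p.2.2.2
  unfold RT
  nlinarith

lemma le_RT (ν : Measure ℝ) [IsProbabilityMeasure ν] (p) : ν.real (Iio p.1) ≤ RT ν p := by
  have := Iio_le_Iic ν p.1
  have h0 := p.2.2.1
  have h1 := p.2.2.2
  unfold RT
  nlinarith

lemma RT_mono (ν : Measure ℝ) [IsProbabilityMeasure ν] (u : unitInterval) :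
    Monotone fun b => RT ν (b, u) := by
  intro a b h
  have h1 := mono_Iio ν h
  have h2 := mono_Iic ν h
  have h3 := u.2.1
  have h4 := u.2.2
  simp only [RT] at *
  nlinarith

lemma Iio_le_of (ν : Measure ℝ) [IsProbabilityMeasure ν] {s t : ℝ}
    (h : ∀ b < s, ν.real (Iic b) ≤ t) : ν.real (Iio s) ≤ t := by
  have e : ν.real (Iio s) = Function.leftLim (ProbabilityTheory.cdf ν) s := by
    have := (ProbabilityTheory.cdf ν).measure_Iio (ProbabilityTheory.tendsto_cdf_atBot ν) s
    rw [ProbabilityTheory.measure_cdf] at this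
    rw [measureReal_def, this, ENNReal.toReal_ofReal, sub_zero]
    rw [sub_zero]
    exact (ProbabilityTheory.cdf_nonneg ν (s - 1)).trans
      ((ProbabilityTheory.monotone_cdf ν).le_leftLim (by linarith))
  rw [e]
  refine le_of_tendsto ((ProbabilityTheory.monotone_cdf ν).tendsto_leftLim s) ?_
  filter_upwards [self_mem_nhdsWithin] with b hb
  rw [ProbabilityTheory.cdf_eq_real]
  exact h b hb

lemma le_Iic_of (ν : Measure ℝ) [IsProbabilityMeasure ν] {s t : ℝ}
    (h : ∀ b > s, t ≤ ν.real (Iic b)) : t ≤ ν.real (Iic s) := by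
  have h1 := ((ProbabilityTheory.cdf ν).right_continuous s).mono Ioi_subset_Ici_self
  rw [← ProbabilityTheory.cdf_eq_real]
  refine ge_of_tendsto h1 ?_
  filter_upwards [self_mem_nhdsWithin] with b hb
  rw [ProbabilityTheory.cdf_eq_real]
  exact h b hb

lemma exists_Iic_lt (ν : Measure ℝ) [IsProbabilityMeasure ν] {t : ℝ} (ht : 0 < t) :
    ∃ b, ν.real (Iic b) < t := by
  have := (ProbabilityTheory.tendsto_cdf_atBot ν).eventually (gt_mem_nhds ht)
  obtain ⟨b, hb⟩ := this.exists
  exact ⟨b, by rwa [← ProbabilityTheory.cdf_eq_real]⟩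

lemma exists_lt_Iic (ν : Measure ℝ) [IsProbabilityMeasure ν] {t : ℝ} (ht : t < 1) :
    ∃ b, t < ν.real (Iic b) := by
  have := (ProbabilityTheory.tendsto_cdf_atTop ν).eventually (lt_mem_nhds ht)
  obtain ⟨b, hb⟩ := this.exists
  exact ⟨b, by rwa [← ProbabilityTheory.cdf_eq_real]⟩

lemma RT_law_Ioo (ν : Measure ℝ) [IsProbabilityMeasure ν] {t : ℝ} (ht : 0 < t) (ht1 : t < 1) :
    (ν.prod volume).real {p | RT ν p ≤ t} = t := by
  set S : Set ℝ := {b | t < ν.real (Iic b)} with hS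
  have hne : S.Nonempty := exists_lt_Iic ν ht1
  have hbd : BddBelow S := by
    obtain ⟨b, hb⟩ := exists_Iic_lt ν ht
    refine ⟨b, fun x hx => ?_⟩
    by_contra hc
    push Not at hc
    have := mono_Iic ν hc.le
    simp only [hS, mem_ofPred_eq] at hx this
    linarith
  set s := sInf S with hs
  have hlt : ∀ b < s, ν.real (Iic b) ≤ t := fun b hb => by
    by_contra hc
    push Not at hc
    exact absurd (csInf_le hbd (show b ∈ S from hc)) (not_le.2 hb)
  have hgt : ∀ b > s, t < ν.real (Iio b) := fun b hb => by
    obtain ⟨c, hc, hcb⟩ := exists_lt_of_csInf_lt hne hb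
    exact lt_of_lt_of_le hc (measureReal_mono (Iic_subset_Iio.2 hcb))
  have hG := Iio_le_of ν hlt
  have hF := le_Iic_of ν (fun b hb => (hgt b hb).le.trans (Iio_le_Iic ν b))
  set G := ν.real (Iio s) with hGd
  set F := ν.real (Iic s) with hFd
  have hsing : ν.real {s} = F - G := by
    rw [hFd, hGd, ← Iic_sdiff_right, measureReal_sdiff (by simp) (by simp)]; ring
  have hset : {p | RT ν p ≤ t} = (Iio s ×ˢ univ) ∪ ({s} ×ˢ {u : unitInterval | u * (F - G) ≤ t - G}) := by
    ext ⟨b, u⟩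
    simp only [mem_ofPred_eq, mem_union, mem_prod, mem_Iio, mem_univ, and_true, mem_singleton_iff]
    rcases lt_trichotomy b s with h | h | h
    · simp only [h, true_or, iff_true]
      exact (RT_le ν _).trans (hlt b h)
    · subst h
      simp only [lt_irrefl, true_and, false_or, RT]
      constructor <;> intro h <;> linarith
    · have h1 := le_RT ν (b, u)
      have h2 := hgt b h
      simp only [not_lt.2 h.le, h.ne', false_and, or_false, iff_false, not_le]
      exact h2.trans_le h1
  have hm : MeasurableSet {u : unitInterval | u * (F - G) ≤ t - G} :=
    measurableSet_le (measurable_subtype_coe.mul_const _) measurable_const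
  rw [hset, measureReal_union _ ((measurableSet_singleton s).prod hm), measureReal_prod_prod,
    measureReal_prod_prod, hsing]
  · simp only [probReal_univ, mul_one]
    rcases eq_or_lt_of_le (hG.trans hF) with h | h
    · rw [← hGd, h]; simp; linarith
    · have hc : (t - G) / (F - G) ∈ Icc (0:ℝ) 1 :=
        ⟨div_nonneg (by linarith) (by linarith), (div_le_one (by linarith)).2 (by linarith)⟩
      have : {u : unitInterval | u * (F - G) ≤ t - G} = Iic (⟨_, hc⟩ : unitInterval) := by
        ext u
        rw [mem_Iic, ← Subtype.coe_le_coe, mem_ofPred_eq, le_div_iff₀ (by linarith)]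
      rw [this, measureReal_def volume, unitInterval.volume_Iic, ENNReal.toReal_ofReal hc.1, ← hGd]
      have : F - G ≠ 0 := by linarith
      field_simp
      ring
  · rw [Set.disjoint_left]
    rintro ⟨b, u⟩ h1 h2
    simp only [mem_prod, mem_Iio, mem_singleton_iff] at h1 h2
    linarith [h1.1, h2.1]

lemma RT_law (ν : Measure ℝ) [IsProbabilityMeasure ν] {t : ℝ} (ht : 0 ≤ t) (ht1 : t ≤ 1) :
    (ν.prod volume).real {p | RT ν p ≤ t} = t := by
  rcases ht1.eq_or_lt with rfl | ht1
  · have : {p | RT ν p ≤ 1} = univ := by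
      ext p; simp only [mem_ofPred_eq, mem_univ, iff_true]
      exact (RT_le ν p).trans measureReal_le_one
    rw [this]; simp
  rcases ht.eq_or_lt with rfl | ht
  · refine le_antisymm ?_ measureReal_nonneg
    refine le_of_forall_pos_le_add fun δ hδ => ?_
    rw [zero_add]
    have h := RT_law_Ioo ν (t := min δ (1/2)) (by positivity) (by
      exact (min_le_right _ _).trans_lt (by norm_num))
    refine le_trans (le_trans (measureReal_mono ?_) h.le) (min_le_left _ _)
    intro p hp
    have hp : RT ν p ≤ 0 := hp
    exact hp.trans (by positivity)
  · exact RT_law_Ioo ν ht ht1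

/-- Quantile function. -/
noncomputable def Qt (μ : Measure ℝ) (p : ℝ) : ℝ :=
  if p ∈ Ioc (0:ℝ) 1 then sInf {x | p ≤ μ.real (Iic x)} else 0

lemma Qt_le_iff (μ : Measure ℝ) [IsProbabilityMeasure μ] {H : ℝ} (hH : μ (Iic H) = 1)
    {p : ℝ} (hp : p ∈ Ioc (0:ℝ) 1) (x : ℝ) : Qt μ p ≤ x ↔ p ≤ μ.real (Iic x) := by
  rw [Qt, if_pos hp]
  set S := {x | p ≤ μ.real (Iic x)} with hS
  have hne : S.Nonempty := ⟨H, by simp [hS, measureReal_def, hH, hp.2]⟩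
  have hbd : BddBelow S := by
    obtain ⟨b, hb⟩ := exists_Iic_lt μ hp.1
    refine ⟨b, fun x hx => ?_⟩
    by_contra hc
    push Not at hc
    have := mono_Iic μ hc.le
    simp only [hS, mem_ofPred_eq] at hx this
    linarith
  constructor
  · intro h
    refine le_Iic_of μ fun b hb => ?_
    obtain ⟨c, hc, hcb⟩ := exists_lt_of_csInf_lt hne (h.trans_lt hb)
    exact le_trans hc (mono_Iic μ hcb.le)
  · intro h
    exact csInf_le hbd h

lemma Qt_meas (μ : Measure ℝ) [IsProbabilityMeasure μ] {H : ℝ} (hH : μ (Iic H) = 1) :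
    Measurable (Qt μ) := by
  refine measurable_of_Iic fun x => ?_
  have : Qt μ ⁻¹' Iic x = (Ioc 0 1 ∩ Iic (μ.real (Iic x))) ∪ ((Ioc 0 1)ᶜ ∩ {_p | 0 ≤ x}) := by
    ext p
    by_cases hp : p ∈ Ioc (0:ℝ) 1
    · simp only [mem_preimage, mem_Iic, Qt_le_iff μ hH hp, mem_union, mem_inter_iff, hp,
        mem_compl_iff, true_and, not_true, false_and, or_false]
    · have hq : Qt μ p = 0 := if_neg hp
      simp only [mem_preimage, mem_Iic, hq, mem_union, mem_inter_iff, hp,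
        mem_compl_iff, false_and, false_or, not_false_iff, true_and, mem_ofPred_eq]
  rw [this]
  exact (measurableSet_Ioc.inter measurableSet_Iic).union
    (measurableSet_Ioc.compl.inter (MeasurableSet.const _))

/-- Circular shift. -/
noncomputable def Sh (ε r : ℝ) : ℝ := if ε < r then r - ε else r - ε + 1

lemma Sh_meas (ε : ℝ) : Measurable (Sh ε) :=
  Measurable.ite measurableSet_Ioi (by fun_prop) (by fun_prop)

lemma coupling (μ ν : Measure ℝ) [IsProbabilityMeasure μ] [IsProbabilityMeasure ν] {H ε : ℝ}
    (hH : μ (Iic H) = 1) (hε : 0 < ε) (hK : KolmogorovLe μ ν ε) :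
    ∃ (W : ℝ × unitInterval → ℝ) (A : Set (ℝ × unitInterval)),
      MeasurePreserving W (ν.prod volume) μ ∧ MeasurableSet A ∧
      (ν.prod volume).real Aᶜ ≤ ε ∧ (∀ p ∈ A, W p ≤ p.1) ∧
      (∀ u b b', b ≤ b' → (b, u) ∈ A → (b', u) ∈ A ∧ W (b, u) ≤ W (b', u)) := by
  obtain ⟨δ, hδ0, hδ1, hδε, hKδ⟩ : ∃ δ, 0 < δ ∧ δ ≤ 1 ∧ δ ≤ ε ∧ KolmogorovLe μ ν δ := by
    refine ⟨min ε 1, by positivity, min_le_right _ _, min_le_left _ _, fun x => le_min (hK x) ?_⟩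
    have h1 : μ.real (Iic x) ≤ 1 := measureReal_le_one
    have h2 : ν.real (Iic x) ≤ 1 := measureReal_le_one
    have h3 : 0 ≤ μ.real (Iic x) := measureReal_nonneg
    have h4 : 0 ≤ ν.real (Iic x) := measureReal_nonneg
    simp only [measureReal_def] at *
    rw [abs_le]; constructor <;> linarith
  have hR1 : ∀ p, RT ν p ≤ 1 := fun p => (RT_le ν p).trans measureReal_le_one
  have hmono : ∀ {p q}, p ∈ Ioc (0:ℝ) 1 → q ∈ Ioc (0:ℝ) 1 → p ≤ q → Qt μ p ≤ Qt μ q := by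
    intro p q hp hq h
    rw [Qt_le_iff μ hH hp]
    exact h.trans ((Qt_le_iff μ hH hq _).1 le_rfl)
  have hrm := RT_meas ν
  have hWm : Measurable fun p => Qt μ (Sh δ (RT ν p)) :=
    (Qt_meas μ hH).comp ((Sh_meas δ).comp hrm)
  refine ⟨fun p => Qt μ (Sh δ (RT ν p)), {p | δ < RT ν p}, ⟨hWm, ?_⟩,
    measurableSet_lt measurable_const hrm, ?_, ?_, ?_⟩
  · have := Measure.isProbabilityMeasure_map (μ := ν.prod (volume : Measure unitInterval)) hWm.aemeasurable
    refine Measure.ext_of_Iic _ _ fun x => ?_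
    rw [Measure.map_apply hWm measurableSet_Iic]
    rw [← ENNReal.toReal_eq_toReal_iff' (measure_ne_top _ _) (measure_ne_top _ _)]
    change (ν.prod volume).real _ = μ.real _
    set c := μ.real (Iic x) with hc
    have hc0 : 0 ≤ c := measureReal_nonneg
    have hc1 : c ≤ 1 := measureReal_le_one
    have hpos : ∀ᵐ p ∂(ν.prod (volume : Measure unitInterval)), 0 < RT ν p := by
      have := RT_law ν le_rfl zero_le_one
      rw [measureReal_eq_zero_iff] at this
      rw [ae_iff]; simpa using this
    have hset : (fun p => Qt μ (Sh δ (RT ν p))) ⁻¹' Iic x =ᵐ[ν.prod volume]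
        ({p | RT ν p ≤ min (c + δ) 1} \ {p | RT ν p ≤ δ} ∪ {p | RT ν p ≤ max (c + δ - 1) 0} : Set _) := by
      filter_upwards [hpos] with p hp
      rw [eq_iff_iff]
      change Qt μ (Sh δ (RT ν p)) ≤ x ↔ (RT ν p ≤ min (c + δ) 1 ∧ ¬ RT ν p ≤ δ) ∨ RT ν p ≤ max (c + δ - 1) 0
      have hp1 := hR1 p
      set r := RT ν p
      rw [Qt_le_iff μ hH (by unfold Sh; split_ifs <;> constructor <;> linarith), ← hc, Sh]
      split_ifs with h
      · rw [le_min_iff, le_max_iff]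
        constructor
        · intro h'; left; exact ⟨⟨by linarith, hp1⟩, not_le.2 h⟩
        · rintro (⟨⟨h1, _⟩, _⟩ | h1 | h1) <;> linarith
      · push Not at h
        rw [le_max_iff]
        constructor
        · intro h'; right; left; linarith
        · rintro (⟨_, h1⟩ | h1 | h1)
          · exact absurd h h1
          · linarith
          · linarith
    rw [measureReal_congr hset, measureReal_union _ (measurableSet_le hrm measurable_const),
      measureReal_sdiff _ (measurableSet_le hrm measurable_const), RT_law, RT_law, RT_law]
    · rcases le_total (c + δ) 1 with h | h
      · rw [min_eq_left h, max_eq_right (by linarith)]; ring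
      · rw [min_eq_right h, max_eq_left (by linarith)]; ring
    any_goals positivity
    any_goals linarith
    · exact max_le (by linarith) zero_le_one
    · exact min_le_right _ _
    · intro p hp
      exact le_trans hp (le_min (by linarith) hδ1)
    · rw [Set.disjoint_left]
      rintro p ⟨_, h1⟩ h2
      exact h1 (le_trans h2 (max_le (by linarith) hδ0.le))
  · have : {p | δ < RT ν p}ᶜ = {p | RT ν p ≤ δ} := by ext; simp
    rw [this, RT_law ν hδ0.le hδ1]
    exact hδε
  · intro p hp
    have hp : δ < RT ν p := hp
    have h1 := hR1 p
    simp only [Sh, if_pos hp]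
    rw [Qt_le_iff μ hH ⟨by linarith, by linarith⟩]
    have h2 := (abs_le.1 (hKδ p.1)).1
    have h3 := RT_le ν p
    simp only [measureReal_def] at *
    linarith
  · intro u b b' hb hA
    have hA : δ < RT ν (b, u) := hA
    have h := RT_mono ν u hb
    simp only at h
    have hA' : δ < RT ν (b', u) := hA.trans_le h
    refine ⟨hA', ?_⟩
    have h1 := hR1 (b, u)
    have h2 := hR1 (b', u)
    simp only [Sh, if_pos hA, if_pos hA']
    exact hmono ⟨by linarith, by linarith⟩ ⟨by linarith, by linarith⟩ (by linarith)

end SingleItem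

namespace SingleItem

/-- The Myerson mechanism of a monotone allocation rule. -/
noncomputable def ofAlloc {n : ℕ} (y : (Fin n → ℝ) → Fin n → ℝ) (h0 : ∀ b i, 0 ≤ y b i)
    (h1 : ∀ b, ∑ i, y b i ≤ 1) (hm : ∀ i, Measurable fun b => y b i) : Mech n where
  alloc := y
  pay b i := myPay (fun s => y (Function.update b i s) i) (b i)
  alloc_nonneg := h0
  alloc_sum_le_one := h1
  meas_alloc := hm
  meas_pay i := by
    unfold myPay
    simp only [Function.update_eq_self]
    refine ((measurable_pi_apply i).mul (hm i)).sub ?_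
    refine measurable_integral_param (G := fun p : (Fin n → ℝ) × ℝ => y (Function.update p.1 i p.2) i)
      ?_ (measurable_pi_apply i)
    refine (hm i).comp ?_
    exact measurable_update'.comp (measurable_id)

lemma ofAlloc_dsic {n : ℕ} (y : (Fin n → ℝ) → Fin n → ℝ) (h0 : ∀ b i, 0 ≤ y b i)
    (h1 : ∀ b, ∑ i, y b i ≤ 1) (hm : ∀ i, Measurable fun b => y b i)
    (hmono : ∀ b i, Monotone fun s => y (Function.update b i s) i) :
    DSIC (ofAlloc y h0 h1 hm) := by
  intro i v v'
  have := myPay_ic (hmono v i) (v i) v'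
  simpa [util, ofAlloc] using this

lemma ofAlloc_ir {n : ℕ} (y : (Fin n → ℝ) → Fin n → ℝ) (h0 : ∀ b i, 0 ≤ y b i)
    (h1 : ∀ b, ∑ i, y b i ≤ 1) (hm : ∀ i, Measurable fun b => y b i)
    (hz : ∀ b i, b i ≤ 0 → y b i = 0) :
    IR (ofAlloc y h0 h1 hm) := by
  intro i v
  have := myPay_ir (X := fun s => y (Function.update v i s) i) (fun s => h0 _ _)
    (fun s hs => hz _ _ (by simpa using hs)) (v i)
  simpa [util, ofAlloc] using this

lemma alloc_le_one {n : ℕ} (M : Mech n) (b i) : M.alloc b i ≤ 1 :=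
  (Finset.single_le_sum (fun j _ => M.alloc_nonneg b j) (Finset.mem_univ i)).trans
    (M.alloc_sum_le_one b)

lemma dsic_line {n : ℕ} {M : Mech n} (hM : DSIC M) (v : Fin n → ℝ) (i : Fin n) (s s' : ℝ) :
    s * M.alloc (Function.update v i s') i - M.pay (Function.update v i s') i ≤
      s * M.alloc (Function.update v i s) i - M.pay (Function.update v i s) i := by
  have := hM i (Function.update v i s) s'
  simpa [util] using this

lemma ir_line {n : ℕ} {M : Mech n} (hM : IR M) (v : Fin n → ℝ) (i : Fin n) (s : ℝ) :
    0 ≤ s * M.alloc (Function.update v i s) i - M.pay (Function.update v i s) i := by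
  have := hM i (Function.update v i s)
  simpa [util] using this

open Classical in
lemma exists_newMech {n : ℕ} {M : Mech n} (hM : DSIC M) (hI : IR M)
    (τ : Fin n → ℝ → ℝ) (B : Fin n → Set ℝ) (hτ : ∀ i, Measurable (τ i))
    (hB : ∀ i, MeasurableSet (B i)) (hle : ∀ i, ∀ b ∈ B i, τ i b ≤ b)
    (hup : ∀ i b b', b ≤ b' → b ∈ B i → b' ∈ B i ∧ τ i b ≤ τ i b') :
    ∃ M' : Mech n, DSIC M' ∧ IR M' ∧ (∀ b i, 0 ≤ M'.pay b i) ∧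
      ∀ b, (∀ i, b i ∈ B i) → ∀ i, M.pay (fun j => τ j (b j)) i ≤ M'.pay b i := by
  set y : (Fin n → ℝ) → Fin n → ℝ := fun b i =>
    if b i ∈ B i ∧ 0 < τ i (b i) then M.alloc (fun j => τ j (b j)) i else 0 with hy
  have h0 : ∀ b i, 0 ≤ y b i := fun b i => by
    simp only [hy]; split_ifs
    · exact M.alloc_nonneg _ _
    · exact le_rfl
  have h1 : ∀ b, ∑ i, y b i ≤ 1 := fun b => by
    refine le_trans (Finset.sum_le_sum fun i _ => ?_) (M.alloc_sum_le_one (fun j => τ j (b j)))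
    simp only [hy]; split_ifs
    · exact le_rfl
    · exact M.alloc_nonneg _ _
  have hm : ∀ i, Measurable fun b => y b i := fun i => by
    refine Measurable.ite ?_ ((M.meas_alloc i).comp ?_) measurable_const
    · exact ((measurable_pi_apply i) (hB i)).inter
        (measurableSet_lt measurable_const ((hτ i).comp (measurable_pi_apply i)))
    · exact measurable_pi_lambda _ fun j => (hτ j).comp (measurable_pi_apply j)
  have hz : ∀ b i, b i ≤ 0 → y b i = 0 := fun b i hb => by
    simp only [hy]
    rw [if_neg]
    rintro ⟨h, h'⟩
    linarith [hle i _ h]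
  have hline : ∀ b i s, y (Function.update b i s) i =
      if s ∈ B i ∧ 0 < τ i s then
        M.alloc (Function.update (fun j => τ j (b j)) i (τ i s)) i else 0 := by
    intro b i s
    simp only [hy, Function.update_self]
    congr 2
    funext j
    by_cases hj : j = i
    · subst hj; simp
    · simp [hj]
  have hXm : ∀ w i, Monotone fun s => M.alloc (Function.update w i s) i := fun w i =>
    ic_mono (P := fun s => M.pay (Function.update w i s) i) (fun s s' => dsic_line hM w i s s')
  have hmono : ∀ b i, Monotone fun s => y (Function.update b i s) i := by
    intro b i s s' hs
    by_cases h : s ∈ B i ∧ 0 < τ i s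
    · obtain ⟨h2, h3⟩ := hup i s s' hs h.1
      simp only [hline, if_pos h]
      rw [if_pos ⟨h2, h.2.trans_le h3⟩]
      exact hXm _ i h3
    · have : y (Function.update b i s) i = 0 := by rw [hline, if_neg h]
      simp only [this]
      exact h0 _ _
  refine ⟨ofAlloc y h0 h1 hm, ofAlloc_dsic y h0 h1 hm hmono, ofAlloc_ir y h0 h1 hm hz,
    fun b i => myPay_nonneg (hmono b i) _, fun b hb i => ?_⟩
  set w : Fin n → ℝ := fun j => τ j (b j) with hw
  rcases le_or_gt (w i) 0 with h | h
  · have h2 := hI i w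
    have h3 := M.alloc_nonneg w i
    have h4 : 0 ≤ (ofAlloc y h0 h1 hm).pay b i := myPay_nonneg (hmono b i) _
    unfold util at h2
    nlinarith
  · have h2 := pay_le_myPay (X := fun s => M.alloc (Function.update w i s) i)
      (P := fun s => M.pay (Function.update w i s) i) (fun s => M.alloc_nonneg _ _)
      (fun s => alloc_le_one M _ _) (dsic_line hM w i) (ir_line hI w i) h.le
    simp only [Function.update_eq_self] at h2
    refine h2.trans (myPay_mono (hXm w i) (hmono b i) h.le ?_ ?_)
    · simp only [hline]
      rw [if_pos ⟨hb i, h⟩]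
    · intro s
      simp only [hline]
      split_ifs with h5
      · exact hXm w i (hle i s h5.1)
      · exact M.alloc_nonneg _ _

lemma pay_sum_le {n : ℕ} {M : Mech n} (hI : IR M) {H : ℝ} (hH : 0 ≤ H) {b : Fin n → ℝ}
    (hb : ∀ i, b i ≤ H) : ∑ i, M.pay b i ≤ H := by
  have : ∀ i, M.pay b i ≤ H * M.alloc b i := fun i => by
    have h1 := hI i b
    have h2 := M.alloc_nonneg b i
    unfold util at h1
    nlinarith [hb i]
  calc ∑ i, M.pay b i ≤ ∑ i, H * M.alloc b i := Finset.sum_le_sum fun i _ => this i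
    _ = H * ∑ i, M.alloc b i := by rw [Finset.mul_sum]
    _ ≤ H * 1 := mul_le_mul_of_nonneg_left (M.alloc_sum_le_one b) hH
    _ = H := mul_one H

lemma ae_le_pi {n : ℕ} (D : Fin n → Measure ℝ) [∀ i, IsProbabilityMeasure (D i)] {H : ℝ}
    (hD : ∀ i, D i (Iic H) = 1) : ∀ᵐ b ∂(Measure.pi D), ∀ i, b i ≤ H := by
  refine ae_all_iff.2 fun i => ?_
  have h : ∀ᵐ x ∂(D i), x ≤ H := (prob_compl_eq_zero_iff measurableSet_Iic).2 (hD i)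
  exact (measurePreserving_eval D i).quasiMeasurePreserving.ae h

lemma rev_le {n : ℕ} {M : Mech n} (hI : IR M) {H : ℝ} (hH : 0 ≤ H)
    (D : Fin n → Measure ℝ) [∀ i, IsProbabilityMeasure (D i)]
    (hD : ∀ i, D i (Iic H) = 1) : Rev M (Measure.pi D) ≤ H := by
  unfold Rev
  by_cases hint : Integrable (fun b => ∑ i, M.pay b i) (Measure.pi D)
  · have := integral_mono_ae hint (integrable_const H)
      ((ae_le_pi D hD).mono fun b hb => pay_sum_le hI hH hb)
    simpa using this
  · rw [integral_undef hint]; exact hH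

lemma main_step {n : ℕ} {M : Mech n} (hM : DSIC M) (hI : IR M) {H ε : ℝ} (hH : 0 < H)
    (hε : 0 < ε) (D Dhat : Fin n → Measure ℝ)
    [∀ i, IsProbabilityMeasure (D i)] [∀ i, IsProbabilityMeasure (Dhat i)]
    (hD : ∀ i, D i (Iic H) = 1) (hDhat : ∀ i, Dhat i (Iic H) = 1)
    (hK : ∀ i, KolmogorovLe (D i) (Dhat i) ε)
    (hint : Integrable (fun b => ∑ i, M.pay b i) (Measure.pi D)) :
    ∃ M' : Mech n, DSIC M' ∧ IR M' ∧
      Rev M (Measure.pi D) - n * H * ε ≤ Rev M' (Measure.pi Dhat) := by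
  choose W A hW hA hAε hWle hWmono using fun i => coupling (D i) (Dhat i) (hD i) hε (hK i)
  set f : (Fin n → ℝ) → ℝ := fun b => ∑ i, M.pay b i with hf
  set P := (Measure.pi Dhat).prod (Measure.pi fun _ : Fin n => (volume : Measure unitInterval))
    with hP
  have hE := measurePreserving_arrowProdEquivProdArrow ℝ unitInterval (Fin n) Dhat
    (fun _ => volume)
  have hE' := hE.symm
  -- the coupled profile
  set V : (Fin n → ℝ) × (Fin n → unitInterval) → (Fin n → ℝ) :=
    fun p i => W i (p.1 i, p.2 i) with hV
  have hVmp : MeasurePreserving V P (Measure.pi D) :=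
    (measurePreserving_pi _ _ hW).comp hE'
  set C : Fin n → Set ((Fin n → ℝ) × (Fin n → unitInterval)) :=
    fun i => {p | (p.1 i, p.2 i) ∈ (A i)ᶜ} with hC
  have hCm : ∀ i, MeasurableSet (C i) := fun i => by
    have : Measurable fun p : (Fin n → ℝ) × (Fin n → unitInterval) => (p.1 i, p.2 i) := by
      fun_prop
    exact this (hA i).compl
  have hCP : ∀ i, P.real (C i) ≤ ε := fun i => by
    have h1 : MeasurePreserving (fun p : (Fin n → ℝ) × (Fin n → unitInterval) => (p.1 i, p.2 i))
        P ((Dhat i).prod volume) :=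
      (measurePreserving_eval (fun i => (Dhat i).prod (volume : Measure unitInterval)) i).comp hE'
    have h2 := h1.measure_preimage (hA i).compl.nullMeasurableSet
    have h3 : P.real (C i) = ((Dhat i).prod volume).real (A i)ᶜ := by
      rw [measureReal_def, measureReal_def, ← h2]; rfl
    rw [h3]; exact hAε i
  set Z : Set ((Fin n → ℝ) × (Fin n → unitInterval)) := ⋃ i, C i with hZ
  have hZm : MeasurableSet Z := MeasurableSet.iUnion hCm
  have hZP : P.real Z ≤ n * ε := by
    refine (measureReal_iUnion_fintype_le C).trans ?_
    refine (Finset.sum_le_sum fun i _ => hCP i).trans ?_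
    simp
  set g : (Fin n → ℝ) × (Fin n → unitInterval) → ℝ :=
    fun p => f (V p) - Z.indicator (fun _ => H) p with hg
  have hfV : Integrable (fun p => f (V p)) P := hVmp.integrable_comp_of_integrable hint
  have hZi : Integrable (Z.indicator (fun _ => H)) P := (integrable_const H).indicator hZm
  have hgi : Integrable g P := hfV.sub hZi
  have hgint : Rev M (Measure.pi D) - n * H * ε ≤ ∫ p, g p ∂P := by
    have e1 : ∫ p, f (V p) ∂P = Rev M (Measure.pi D) := by
      have h := integral_map (μ := P) (φ := V) (f := f) hVmp.measurable.aemeasurable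
        (by rw [hVmp.map_eq]; exact hint.aestronglyMeasurable)
      rw [hVmp.map_eq] at h
      exact h.symm
    have e2 : ∫ p, Z.indicator (fun _ => H) p ∂P = P.real Z * H := by
      rw [integral_indicator hZm]; simp
    rw [hg, integral_sub hfV hZi, e1, e2]
    nlinarith
  rw [hP, integral_prod_symm _ hgi] at hgint
  obtain ⟨u, hu, hua⟩ : ∃ u : Fin n → unitInterval,
      Rev M (Measure.pi D) - n * H * ε ≤ ∫ b, g (b, u) ∂(Measure.pi Dhat) ∧
      ∀ᵐ b ∂(Measure.pi Dhat), f (V (b, u)) ≤ H := by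
    have hae : ∀ᵐ p ∂P, f (V p) ≤ H := by
      have : ∀ᵐ b ∂(Measure.pi D), f b ≤ H :=
        (ae_le_pi D hD).mono fun b hb => pay_sum_le hI hH.le hb
      exact hVmp.quasiMeasurePreserving.ae this
    have hae2 : ∀ᵐ u ∂(Measure.pi fun _ : Fin n => (volume : Measure unitInterval)),
        ∀ᵐ b ∂(Measure.pi Dhat), f (V (b, u)) ≤ H := by
      have h := (Measure.measurePreserving_swap (μ := Measure.pi fun _ : Fin n => (volume : Measure unitInterval))
        (ν := Measure.pi Dhat)).quasiMeasurePreserving.ae hae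
      exact Measure.ae_ae_of_ae_prod h
    obtain ⟨u, hu1, hu2⟩ := exists_notMem_null_integral_le hgi.integral_prod_right hae2
    exact ⟨u, hgint.trans hu2, by simpa using hu1⟩
  obtain ⟨M', h1, h2, h3, h4⟩ := exists_newMech hM hI (fun i b => W i (b, u i))
    (fun i => {b | (b, u i) ∈ A i})
    (fun i => (hW i).measurable.comp (by fun_prop))
    (fun i => (show Measurable fun b : ℝ => (b, u i) by fun_prop) (hA i))
    (fun i b hb => hWle i _ hb) (fun i b b' hb hbA => hWmono i (u i) b b' hb hbA)
  refine ⟨M', h1, h2, hu.trans ?_⟩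
  have hnn : ∀ b, 0 ≤ ∑ i, M'.pay b i := fun b => Finset.sum_nonneg fun i _ => h3 b i
  by_cases hgu : Integrable (fun b => g (b, u)) (Measure.pi Dhat)
  swap
  · rw [integral_undef hgu]
    exact integral_nonneg hnn
  have hMm : Measurable fun b => ∑ i, M'.pay b i :=
    Finset.measurable_fun_sum _ fun i _ => M'.meas_pay i
  have hMi : Integrable (fun b => ∑ i, M'.pay b i) (Measure.pi Dhat) := by
    refine Integrable.of_bound hMm.aestronglyMeasurable H ?_
    filter_upwards [ae_le_pi Dhat hDhat] with b hb
    rw [Real.norm_of_nonneg (hnn b)]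
    exact pay_sum_le h2 hH.le hb
  refine integral_mono_ae hgu hMi ?_
  filter_upwards [hua] with b hb
  by_cases hbZ : (b, u) ∈ Z
  · simp only [hg, indicator_of_mem hbZ]
    linarith [hnn b]
  · simp only [hg, indicator_of_notMem hbZ, sub_zero]
    refine Finset.sum_le_sum fun i _ => h4 b (fun j => ?_) i
    by_contra hc
    exact hbZ (mem_iUnion.2 ⟨j, hc⟩)

end SingleItem


/-- Kolmogorov-robustness of the optimal revenue, single item: if each
`D i` and `D̂ i` is supported on `(-∞, H]` and they are within Kolmogorov distance `ε`,
then `OPT(D̂) ≥ OPT(D) − 3nH·ε`. -/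
theorem stmt1 (n : ℕ) (H ε : ℝ) (hH : 0 < H) (hε : 0 < ε)
    (D Dhat : Fin n → Measure ℝ)
    (hDprob : ∀ i, IsProbabilityMeasure (D i))
    (hDhatprob : ∀ i, IsProbabilityMeasure (Dhat i))
    (hDsupp : ∀ i, D i (Iic H) = 1)
    (hDhatsupp : ∀ i, Dhat i (Iic H) = 1)
    (hK : ∀ i, KolmogorovLe (D i) (Dhat i) ε) :
    OPT (Measure.pi D) - 3 * n * H * ε ≤ OPT (Measure.pi Dhat) := by
  have hn : (0:ℝ) ≤ n * H * ε := by positivity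
  have hbdd : BddAbove {r | ∃ M : Mech n, DSIC M ∧ IR M ∧ r = Rev M (Measure.pi Dhat)} := by
    refine ⟨H, ?_⟩
    rintro r ⟨M, _, h2, rfl⟩
    exact rev_le h2 hH.le Dhat hDhatsupp
  let M0 : Mech n := ⟨fun _ _ => 0, fun _ _ => 0, by simp, by simp, by simp, by simp⟩
  have hM0 : DSIC M0 := by intro i v v'; simp [util, M0]
  have hM0' : IR M0 := by intro i v; simp [util, M0]
  have hM0r : ∀ D, Rev M0 D = 0 := by intro D; simp [Rev, M0]
  have h0 : 0 ≤ OPT (Measure.pi Dhat) := le_csSup hbdd ⟨M0, hM0, hM0', (hM0r _).symm⟩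
  rw [sub_le_iff_le_add]
  refine csSup_le ⟨0, M0, hM0, hM0', (hM0r _).symm⟩ ?_
  rintro r ⟨M, h1, h2, rfl⟩
  by_cases hint : Integrable (fun b => ∑ i, M.pay b i) (Measure.pi D)
  · obtain ⟨M', h3, h4, h5⟩ := main_step h1 h2 hH hε D Dhat hDsupp hDhatsupp hK hint
    have h6 : Rev M' (Measure.pi Dhat) ≤ OPT (Measure.pi Dhat) :=
      le_csSup hbdd ⟨M', h3, h4, rfl⟩
    linarith
  · rw [Rev, integral_undef hint]
    linarith
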